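/- Let k be a field of characteristic 0 and let r > 2 and n ≥ 1 be integers. Equip the n-fold tensor power gl_r(k)^{⊗n} of the matrix space with the GL_r(k)-action g.(f_1 ⊗ ... ⊗ f_n) = ((g^{-1})^T f_1 g^T) ⊗ ... ⊗ ((g^{-1})^T f_n g^T) and with the gl_r(k)-action h.(f_1 ⊗ ... ⊗ f_n) = Σ_{i=1}^n f_1 ⊗ ... ⊗ (f_i·h^T − h^T·f_i) ⊗ ... ⊗ f_n. Then the subspace of gl_r(k)-invariants (elements annihilated by the action of every h ∈ gl_r(k)) coincides with the subspace of GL_r(k)-invariants (elements fixed by the action of every g ∈ GL_r(k)): (gl_r(k)^{⊗n})^{gl_r(k)} = (gl_r(k)^{⊗n})^{GL_r(k)}. -/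

import Mathlib

/-!
STATEMENT 0: For a field `k` of characteristic zero, `r > 2`, `n ≥ 1`, the
`gl_r(k)`-invariants of the `n`-fold tensor power of the matrix space
(for the action `h.(f_1 ⊗ ⋯ ⊗ f_n) = Σ_i f_1 ⊗ ⋯ ⊗ (f_i hᵀ − hᵀ f_i) ⊗ ⋯ ⊗ f_n`)
coincide with the `GL_r(k)`-invariants (for the action
`g.(f_1 ⊗ ⋯ ⊗ f_n) = ((g⁻¹)ᵀ f_1 gᵀ) ⊗ ⋯ ⊗ ((g⁻¹)ᵀ f_n gᵀ)`).
-/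

open scoped TensorProduct
open Matrix

noncomputable section

namespace Stmt0

variable (k : Type) [Field k] (r n : ℕ)

abbrev Mat (k : Type) [Field k] (r : ℕ) := Matrix (Fin r) (Fin r) k

/-- Conjugation action of `GL_r(k)`: `f ↦ (g⁻¹)ᵀ * f * gᵀ`. -/
def conjMap (g : Matrix.GeneralLinearGroup (Fin r) k) : Mat k r →ₗ[k] Mat k r where
  toFun f := ((g⁻¹ : Matrix.GeneralLinearGroup (Fin r) k) : Matrix (Fin r) (Fin r) k)ᵀ * f *
      ((g : Matrix (Fin r) (Fin r) k))ᵀ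
  map_add' x y := by simp [Matrix.add_mul, Matrix.mul_add]
  map_smul' c x := by simp [Matrix.smul_mul, Matrix.mul_smul]

/-- Infinitesimal action of `gl_r(k)`: `f ↦ f * hᵀ − hᵀ * f`. -/
def derivMap (h : Mat k r) : Mat k r →ₗ[k] Mat k r where
  toFun f := f * hᵀ - hᵀ * f
  map_add' x y := by simp [Matrix.add_mul, Matrix.mul_add]; abel
  map_smul' c x := by simp [Matrix.smul_mul, Matrix.mul_smul, smul_sub]

/-- The induced action of `GL_r(k)` on the `n`-fold tensor power. -/
def glGroupAction (g : Matrix.GeneralLinearGroup (Fin r) k) :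
    (⨂[k] (_ : Fin n), Mat k r) →ₗ[k] ⨂[k] (_ : Fin n), Mat k r :=
  PiTensorProduct.map fun _ => conjMap k r g

/-- The induced action of the Lie algebra `gl_r(k)` on the `n`-fold tensor power:
`h.(f_1 ⊗ ⋯ ⊗ f_n) = Σ_i f_1 ⊗ ⋯ ⊗ (f_i·hᵀ − hᵀ·f_i) ⊗ ⋯ ⊗ f_n`. -/
def glLieAction (h : Mat k r) :
    (⨂[k] (_ : Fin n), Mat k r) →ₗ[k] ⨂[k] (_ : Fin n), Mat k r :=
  ∑ i : Fin n, PiTensorProduct.map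
    (Function.update (fun _ => (LinearMap.id : Mat k r →ₗ[k] Mat k r)) i (derivMap k r h))

/-- Newton: in characteristic zero, a subalgebra containing the power sums contains the elementary
symmetric polynomials. -/
theorem esymm_mem_of_psum_mem {σ K : Type*} [Fintype σ] [Field K] [CharZero K]
    (S : Subalgebra K (MvPolynomial σ K))
    (hS : ∀ j, 0 < j → MvPolynomial.psum σ K j ∈ S) (j : ℕ) :
    MvPolynomial.esymm σ K j ∈ S := by
  induction j using Nat.strong_induction_on with
  | _ j ih =>
    rcases Nat.eq_zero_or_pos j with rfl | hj
    · simp [S.one_mem]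
    have hj0 : (j : K) ≠ 0 := by exact_mod_cast hj.ne'
    have hmem : (j : MvPolynomial σ K) * MvPolynomial.esymm σ K j ∈ S := by
      rw [MvPolynomial.mul_esymm_eq_sum]
      have hneg : (-1 : MvPolynomial σ K) ∈ S := S.neg_mem S.one_mem
      refine S.mul_mem (S.pow_mem hneg _) (S.sum_mem fun a ha => ?_)
      rw [Finset.mem_filter, Finset.HasAntidiagonal.mem_antidiagonal] at ha
      exact S.mul_mem (S.mul_mem (S.pow_mem hneg _) (ih a.1 ha.2)) (hS a.2 (by omega))
    have hsmul := S.smul_mem hmem (j : K)⁻¹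
    rwa [← nsmul_eq_mul, ← Nat.cast_smul_eq_nsmul K, smul_smul, inv_mul_cancel₀ hj0,
      one_smul] at hsmul

section CommutingOperators

variable {ι K C M : Type*} [Field K] [CommRing C] [Algebra K C] [AddCommGroup M] [Module K M]

/-- The polynomials whose values at two families of commuting operators agree on a vector. -/
def agreeSubalgebra (ψ : C →ₐ[K] Module.End K M) (L R : ι → C) (x : M) :
    Subalgebra K (MvPolynomial ι K) where
  carrier := {p | ψ (MvPolynomial.aeval L p) x = ψ (MvPolynomial.aeval R p) x}
  mul_mem' {p q} hp hq := by
    simp only [Set.mem_ofPred_eq] at hp hq ⊢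
    rw [map_mul, map_mul, map_mul, Module.End.mul_apply, hq, ← Module.End.mul_apply, ← map_mul,
      mul_comm, map_mul, Module.End.mul_apply, hp, ← Module.End.mul_apply, ← map_mul, mul_comm]
  add_mem' {p q} hp hq := by
    simp only [Set.mem_ofPred_eq] at hp hq ⊢
    simp [hp, hq]
  algebraMap_mem' c := by simp

theorem mem_agreeSubalgebra {ψ : C →ₐ[K] Module.End K M} {L R : ι → C} {x : M}
    {p : MvPolynomial ι K} : p ∈ agreeSubalgebra ψ L R x ↔
      ψ (MvPolynomial.aeval L p) x = ψ (MvPolynomial.aeval R p) x := Iff.rfl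

/-- If the power sums of two families of commuting operators agree on a vector, so do their
products. -/
theorem prod_apply_eq_of_sum_pow_apply_eq [Fintype ι] [CharZero K] (ψ : C →ₐ[K] Module.End K M)
    (L R : ι → C) (x : M) (h : ∀ j, 0 < j → ψ (∑ i, L i ^ j) x = ψ (∑ i, R i ^ j) x) :
    ψ (∏ i, L i) x = ψ (∏ i, R i) x := by
  have hmem := esymm_mem_of_psum_mem (agreeSubalgebra ψ L R x)
    (fun j hj => by simpa [mem_agreeSubalgebra, MvPolynomial.psum] using h j hj) (Fintype.card ι)
  have hprod : MvPolynomial.esymm ι K (Fintype.card ι) = ∏ i, MvPolynomial.X i := by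
    rw [MvPolynomial.esymm, ← Finset.card_univ, Finset.powersetCard_self, Finset.sum_singleton]
  rw [hprod, mem_agreeSubalgebra] at hmem
  simpa only [map_prod, MvPolynomial.aeval_X] using hmem

/-- A polynomial curve in `C` that kills `x` at infinitely many scalars has all its coefficients
killing `x`. -/
theorem coeff_apply_eq_zero_of_infinite (ψ : C →ₐ[K] Module.End K M) (x : M) (Q : Polynomial C)
    (h : {t : K | ψ (Q.eval (algebraMap K C t)) x = 0}.Infinite) (j : ℕ) :
    ψ (Q.coeff j) x = 0 := by
  refine (Module.forall_dual_apply_eq_zero_iff K _).1 fun φ => ?_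
  let q : Polynomial K := ∑ i ∈ Q.support, Polynomial.monomial i (φ (ψ (Q.coeff i) x))
  have hq : q = 0 := by
    refine Polynomial.eq_zero_of_infinite_isRoot _ (h.mono fun t ht => ?_)
    rw [Set.mem_ofPred_eq] at ht ⊢
    rw [Polynomial.IsRoot, ← map_zero φ, ← ht, Polynomial.eval_eq_sum (p := Q), Polynomial.sum,
      Polynomial.eval_finsetSum, map_sum, LinearMap.sum_apply, map_sum]
    refine Finset.sum_congr rfl fun i _ => ?_
    rw [← map_pow, mul_comm (Q.coeff i), ← Algebra.smul_def]
    simp [mul_comm]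
  have hcoeff : q.coeff j = φ (ψ (Q.coeff j) x) := by
    simp only [q, Polynomial.finsetSum_coeff, Polynomial.coeff_monomial]
    rw [Finset.sum_ite_eq']
    split_ifs with hj
    · rfl
    · rw [Polynomial.notMem_support_iff.1 hj]; simp
  rw [← hcoeff, hq, Polynomial.coeff_zero]

theorem coeff_one_prod_one_add_C_mul_X (s : Finset ι) (L : ι → C) :
    (∏ i ∈ s, (1 + Polynomial.C (L i) * Polynomial.X)).coeff 1 = ∑ i ∈ s, L i := by
  classical
  have hzero (s : Finset ι) :
      (∏ i ∈ s, (1 + Polynomial.C (L i) * Polynomial.X)).coeff 0 = 1 := by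
    simp [Polynomial.coeff_zero_eq_eval_zero, Polynomial.eval_prod]
  induction s using Finset.induction_on with
  | empty => simp [Polynomial.coeff_one]
  | insert a s ha ih =>
    rw [Finset.prod_insert ha, Finset.sum_insert ha, add_mul, one_mul, Polynomial.coeff_add, ih,
      mul_assoc, Polynomial.coeff_C_mul, Polynomial.coeff_X_mul, hzero, mul_one, add_comm]

/-- If `∏ (1 + t Lᵢ)` and `∏ (1 + t Rᵢ)` agree on a vector for infinitely many scalars `t`, then so
do `∑ Lᵢ` and `∑ Rᵢ`. -/
theorem sum_apply_eq_of_infinite_prod_apply_eq [Fintype ι] (ψ : C →ₐ[K] Module.End K M)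
    (L R : ι → C) (x : M)
    (h : {t : K | ψ (∏ i, (1 + t • L i)) x = ψ (∏ i, (1 + t • R i)) x}.Infinite) :
    ψ (∑ i, L i) x = ψ (∑ i, R i) x := by
  have hcoeff := coeff_apply_eq_zero_of_infinite ψ x
    (∏ i, (1 + Polynomial.C (L i) * Polynomial.X) - ∏ i, (1 + Polynomial.C (R i) * Polynomial.X))
    (h.mono fun t ht => by
      rw [Set.mem_ofPred_eq] at ht ⊢
      simp only [Algebra.smul_def, mul_comm (algebraMap K C t)] at ht
      simp only [Polynomial.eval_sub, Polynomial.eval_prod, Polynomial.eval_add,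
        Polynomial.eval_one, Polynomial.eval_mul, Polynomial.eval_C, Polynomial.eval_X, map_sub,
        LinearMap.sub_apply, ht, sub_self]) 1
  rwa [Polynomial.coeff_sub, coeff_one_prod_one_add_C_mul_X, coeff_one_prod_one_add_C_mul_X,
    map_sub, LinearMap.sub_apply, sub_eq_zero] at hcoeff

end CommutingOperators

/-- Evaluation of polynomials at a family of commuting elements of an algebra. -/
theorem exists_algHom_of_commute {σ K E : Type*} [Field K] [Ring E] [Algebra K E] (a : σ → E)
    (h : ∀ i j, Commute (a i) (a j)) :
    ∃ ψ : MvPolynomial σ K →ₐ[K] E, ∀ i, ψ (MvPolynomial.X i) = a i := by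
  have hcomm : IsMulCommutative (Algebra.adjoin K (Set.range a)) :=
    Algebra.isMulCommutative_adjoin K (by rintro _ ⟨i, rfl⟩ _ ⟨j, rfl⟩; exact h i j)
  let _ : CommRing (Algebra.adjoin K (Set.range a)) :=
    { (inferInstance : Ring (Algebra.adjoin K (Set.range a))) with
      mul_comm := hcomm.is_comm.comm }
  refine ⟨(Algebra.adjoin K (Set.range a)).val.comp
    (MvPolynomial.aeval fun i => ⟨a i, Algebra.subset_adjoin ⟨i, rfl⟩⟩), fun i => ?_⟩
  simp

section Slot

variable {ι K V : Type*} [DecidableEq ι] [Field K] [AddCommGroup V] [Module K V]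

/-- The operator on a tensor power applying an endomorphism in one slot. -/
def slot (i : ι) : Module.End K V →ₗ[K] Module.End K (⨂[K] _ : ι, V) :=
  (PiTensorProduct.mapMultilinear K (fun _ : ι => V) fun _ => V).toLinearMap 1 i

theorem slot_eq (i : ι) (f : Module.End K V) :
    slot i f = PiTensorProduct.mapMonoidHom (Pi.mulSingle i f : ι → Module.End K V) := rfl

theorem slot_one (i : ι) : slot i (1 : Module.End K V) = 1 := by
  rw [slot_eq, Pi.mulSingle_one, map_one]

theorem slot_mul (i : ι) (f g : Module.End K V) : slot i (f * g) = slot i f * slot i g := by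
  rw [slot_eq, Pi.mulSingle_mul, map_mul]; rfl

theorem slot_pow (i : ι) (f : Module.End K V) (j : ℕ) : slot i (f ^ j) = slot i f ^ j := by
  induction j with
  | zero => simp [slot_one]
  | succ j ih => rw [pow_succ, pow_succ, slot_mul, ih]

theorem slot_commute {f g : Module.End K V} (h : Commute f g) (i j : ι) :
    Commute (slot i f) (slot j g) := by
  rcases eq_or_ne i j with rfl | hij
  · rw [Commute, SemiconjBy, ← slot_mul, ← slot_mul, h.eq]
  · have hc : Commute (Pi.mulSingle i f : ι → Module.End K V) (Pi.mulSingle j g) :=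
      Pi.mulSingle_commute (f := fun _ : ι => Module.End K V) hij f g
    rw [Commute, SemiconjBy, slot_eq, slot_eq, ← map_mul, hc.eq, map_mul]

theorem algHom_prod_eq_map [Fintype ι] {C : Type*} [CommRing C] [Algebra K C]
    (ψ : C →ₐ[K] Module.End K (⨂[K] _ : ι, V)) (c : ι → C) (f : Module.End K V)
    (h : ∀ i, ψ (c i) = slot i f) :
    ψ (∏ i, c i) = PiTensorProduct.map fun _ : ι => f := by
  have key (s : Finset ι) : ψ (∏ i ∈ s, c i) =
      PiTensorProduct.mapMonoidHom fun i : ι => if i ∈ s then f else 1 := by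
    induction s using Finset.induction_on with
    | empty => simp
    | insert a s ha ih =>
      rw [Finset.prod_insert ha, map_mul, ih, h, slot_eq, ← map_mul]
      congr 1
      funext i
      rcases eq_or_ne i a with rfl | hia
      · simp [ha]
      · simp [hia]
  simpa using key Finset.univ

/-- For commuting endomorphisms `f`, `g` of `V`, polynomials can be evaluated at the operators
applying `f` or `g` in one slot. -/
theorem exists_algHom_slot {f g : Module.End K V} (h : Commute f g) :
    ∃ (ψ : MvPolynomial (ι ⊕ ι) K →ₐ[K] Module.End K (⨂[K] _ : ι, V)),
      (∀ i, ψ (MvPolynomial.X (Sum.inl i)) = slot i f) ∧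
      ∀ i, ψ (MvPolynomial.X (Sum.inr i)) = slot i g := by
  obtain ⟨ψ, hψ⟩ := exists_algHom_of_commute (K := K)
    (Sum.elim (fun i : ι => slot i f) fun i => slot i g) (by
      rintro (i | i) (j | j)
      exacts [slot_commute (.refl f) i j, slot_commute h i j, slot_commute h.symm i j,
        slot_commute (.refl g) i j])
  exact ⟨ψ, fun i => hψ (Sum.inl i), fun i => hψ (Sum.inr i)⟩

theorem map_apply_eq_of_sum_slot_pow_apply_eq [Fintype ι] [CharZero K] {f g : Module.End K V}
    (hfg : Commute f g) (x : ⨂[K] _ : ι, V)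
    (h : ∀ j, 0 < j → (∑ i, slot i (f ^ j)) x = (∑ i, slot i (g ^ j)) x) :
    PiTensorProduct.map (fun _ : ι => f) x = PiTensorProduct.map (fun _ : ι => g) x := by
  obtain ⟨ψ, hf, hg⟩ := exists_algHom_slot (ι := ι) hfg
  rw [← algHom_prod_eq_map ψ _ f hf, ← algHom_prod_eq_map ψ _ g hg]
  refine prod_apply_eq_of_sum_pow_apply_eq ψ _ _ x fun j hj => ?_
  simpa only [map_sum, map_pow, hf, hg, slot_pow] using h j hj

theorem sum_slot_apply_eq_of_infinite [Fintype ι] {f g : Module.End K V}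
    (hfg : Commute f g) (x : ⨂[K] _ : ι, V)
    (h : {t : K | PiTensorProduct.map (fun _ : ι => 1 + t • f) x =
      PiTensorProduct.map (fun _ : ι => 1 + t • g) x}.Infinite) :
    (∑ i, slot i f) x = (∑ i, slot i g) x := by
  obtain ⟨ψ, hf, hg⟩ := exists_algHom_slot (ι := ι) hfg
  have key := sum_apply_eq_of_infinite_prod_apply_eq ψ (fun i => MvPolynomial.X (Sum.inl i))
    (fun i => MvPolynomial.X (Sum.inr i)) x (h.mono fun t ht => by
      rw [Set.mem_ofPred_eq] at ht ⊢
      rw [algHom_prod_eq_map ψ _ (1 + t • f) (by simp [hf, slot_one]),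
        algHom_prod_eq_map ψ _ (1 + t • g) (by simp [hg, slot_one])]
      exact ht)
  simpa only [map_sum, hf, hg] using key

end Slot

theorem infinite_det_one_add_smul_ne_zero {m K : Type*} [Fintype m] [DecidableEq m] [Field K]
    [Infinite K] (A : Matrix m m K) : {t : K | (1 + t • A).det ≠ 0}.Infinite := by
  let p : Polynomial K := (1 + (Polynomial.X : Polynomial K) • A.map Polynomial.C).det
  have heval (t : K) : p.eval t = (1 + t • A).det := by
    simp only [p]
    rw [← Polynomial.coe_evalRingHom, RingHom.map_det]
    congr 1
    ext i j
    by_cases hij : i = j <;> simp [hij, mul_comm t]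
  have hp : p ≠ 0 := by
    intro h0
    have h1 := heval 0
    simp [h0] at h1
  refine ((Polynomial.finite_setOfPred_isRoot hp).infinite_compl).mono fun t ht => ?_
  rw [Set.mem_ofPred_eq, ← heval]
  exact ht

theorem glLieAction_apply_eq_zero_iff (h : Mat k r) (x : ⨂[k] (_ : Fin n), Mat k r) :
    glLieAction k r n h x = 0 ↔
      (∑ i, slot i (LinearMap.mulRight k hᵀ)) x = (∑ i, slot i (LinearMap.mulLeft k hᵀ)) x := by
  have hderiv : derivMap k r h = LinearMap.mulRight k hᵀ - LinearMap.mulLeft k hᵀ := rfl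
  have hsum : glLieAction k r n h = ∑ i, slot i (derivMap k r h) := rfl
  rw [hsum, hderiv]
  simp only [map_sub, Finset.sum_sub_distrib, LinearMap.sub_apply, sub_eq_zero]

theorem glGroupAction_apply_eq_iff (g : Matrix.GeneralLinearGroup (Fin r) k)
    (x : ⨂[k] (_ : Fin n), Mat k r) :
    glGroupAction k r n g x = x ↔
      PiTensorProduct.map (fun _ => LinearMap.mulRight k (g : Mat k r)ᵀ) x =
        PiTensorProduct.map (fun _ => LinearMap.mulLeft k (g : Mat k r)ᵀ) x := by
  have hinv : ((g⁻¹ : Matrix.GeneralLinearGroup (Fin r) k) : Mat k r)ᵀ * (g : Mat k r)ᵀ = 1 := by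
    rw [← Matrix.transpose_mul, ← Units.val_mul, mul_inv_cancel, Units.val_one,
      Matrix.transpose_one]
  have hinv' : (g : Mat k r)ᵀ * ((g⁻¹ : Matrix.GeneralLinearGroup (Fin r) k) : Mat k r)ᵀ = 1 := by
    rw [← Matrix.transpose_mul, ← Units.val_mul, inv_mul_cancel, Units.val_one,
      Matrix.transpose_one]
  have hleft : ∀ y, PiTensorProduct.map (fun _ : Fin n => LinearMap.mulLeft k (g : Mat k r)ᵀ)
      (glGroupAction k r n g y) =
      PiTensorProduct.map (fun _ => LinearMap.mulRight k (g : Mat k r)ᵀ) y := by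
    intro y
    rw [glGroupAction, ← LinearMap.comp_apply, ← PiTensorProduct.map_comp]
    congr 2
    funext _
    ext1 f
    simp only [conjMap, LinearMap.comp_apply, LinearMap.coe_mk, AddHom.coe_mk,
      LinearMap.mulLeft_apply, LinearMap.mulRight_apply, ← Matrix.mul_assoc, hinv',
      Matrix.one_mul]
  have hinj : Function.Injective
      (PiTensorProduct.map fun _ : Fin n => LinearMap.mulLeft k (g : Mat k r)ᵀ) := by
    refine Function.LeftInverse.injective (g := PiTensorProduct.map fun _ : Fin n =>
      LinearMap.mulLeft k ((g⁻¹ : Matrix.GeneralLinearGroup (Fin r) k) : Mat k r)ᵀ) fun y => ?_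
    rw [← LinearMap.comp_apply, ← PiTensorProduct.map_comp]
    simp only [← LinearMap.mulLeft_mul, hinv, LinearMap.mulLeft_one, PiTensorProduct.map_id,
      LinearMap.id_apply]
  rw [← hinj.eq_iff, hleft]

/-- In characteristic zero, for `r > 2` and `n ≥ 1`, the Lie algebra
invariants agree with the group invariants on `gl_r(k)^{⊗ n}`. -/
theorem glInvariants_eq_GLInvariants [CharZero k] (hr : 2 < r) (hn : 1 ≤ n) :
    {x : ⨂[k] (_ : Fin n), Mat k r | ∀ h : Mat k r, glLieAction k r n h x = 0} =
    {x : ⨂[k] (_ : Fin n), Mat k r |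
      ∀ g : Matrix.GeneralLinearGroup (Fin r) k, glGroupAction k r n g x = x} := by
  ext x
  simp only [Set.mem_ofPred_eq, glLieAction_apply_eq_zero_iff, glGroupAction_apply_eq_iff]
  constructor
  · intro hx g
    refine map_apply_eq_of_sum_slot_pow_apply_eq
      (LinearMap.commute_mulLeft_right _ _).symm x fun j _ => ?_
    simpa only [LinearMap.pow_mulLeft, LinearMap.pow_mulRight, Matrix.transpose_pow] using
      hx ((g : Mat k r) ^ j)
  · intro hx h
    refine sum_slot_apply_eq_of_infinite (LinearMap.commute_mulLeft_right _ _).symm x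
      ((infinite_det_one_add_smul_ne_zero h).mono fun t ht => ?_)
    have hright : LinearMap.mulRight k (1 + t • h)ᵀ = 1 + t • LinearMap.mulRight k hᵀ := by
      ext1 f
      simp [Matrix.mul_add]
    have hleft : LinearMap.mulLeft k (1 + t • h)ᵀ = 1 + t • LinearMap.mulLeft k hᵀ := by
      ext1 f
      simp [Matrix.add_mul]
    rw [Set.mem_ofPred_eq, ← hright, ← hleft]
    exact hx (Matrix.GeneralLinearGroup.mkOfDetNeZero (1 + t • h) ht)

end Stmt0
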